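/- Let s be a finite multiset of integers, each at least 3, with card s ≥ 3 and combinatorial curvature Φ(s) = 1 − (card s)/2 + Σ_{k ∈ s} 1/k ≥ 0. If s contains both the element 3 and the element 11, then s is one of the following: {3,m,11} for some integer 3 ≤ m ≤ 13, or {3,3,3,11}, or {3,3,4,11}. -/

import Mathlib

/-- Combinatorial curvature of a vertex pattern `s` (multiset of face degrees). -/
def curvature (s : Multiset ℤ) : ℚ :=
  1 - (s.card : ℚ) / 2 + (s.map (fun k => (1 : ℚ) / (k : ℚ))).sum

theorem curvature_eq (s : Multiset ℤ) :
    curvature s = 1 - (s.card : ℚ) / 2 + (s.map (fun k : ℤ => (1 : ℚ) / (k : ℚ))).sum := by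
  simp [curvature, Multiset.bind_def, Multiset.pure_def, Multiset.bind_singleton]

theorem curvature_zero : curvature 0 = 1 := by
  simp [curvature_eq]

theorem curvature_cons (k : ℤ) (s : Multiset ℤ) :
    curvature (k ::ₘ s) = curvature s + (1 / (k : ℚ) - 1 / 2) := by
  simp only [curvature_eq, Multiset.card_cons, Multiset.map_cons, Multiset.sum_cons]
  push_cast
  ring

theorem curvature_le_one_sub_card_div_six {s : Multiset ℤ} (hs : ∀ k ∈ s, (3 : ℤ) ≤ k) :
    curvature s ≤ 1 - (s.card : ℚ) / 6 := by
  have h : (s.map (fun k : ℤ => (1 : ℚ) / (k : ℚ))).sum ≤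
      (s.map (fun k : ℤ => (1 : ℚ) / (k : ℚ))).card • (1 / 3 : ℚ) := by
    refine Multiset.sum_le_card_nsmul _ _ fun x hx => ?_
    obtain ⟨k, hk, rfl⟩ := Multiset.mem_map.1 hx
    have hk3 : (3 : ℚ) ≤ k := by exact_mod_cast hs k hk
    exact one_div_le_one_div_of_le (by norm_num) hk3
  rw [Multiset.card_map, nsmul_eq_mul] at h
  rw [curvature_eq]
  linarith

theorem patterns_with_three_and_eleven (s : Multiset ℤ)
    (h3 : ∀ k ∈ s, (3 : ℤ) ≤ k) (hcard : 3 ≤ Multiset.card s)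
    (hΦ : 0 ≤ curvature s) (h3mem : (3 : ℤ) ∈ s) (h11mem : (11 : ℤ) ∈ s) :
    (∃ m : ℤ, 3 ≤ m ∧ m ≤ 13 ∧ s = {3, m, 11}) ∨
      s = {3, 3, 3, 11} ∨ s = {3, 3, 4, 11} := by
  obtain ⟨u, rfl⟩ := Multiset.exists_cons_of_mem h3mem
  have h11u : (11 : ℤ) ∈ u := by simpa using h11mem
  obtain ⟨t, rfl⟩ := Multiset.exists_cons_of_mem h11u
  have ht : ∀ k ∈ t, (3 : ℤ) ≤ k := fun k hk => h3 k (by simp [hk])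
  simp only [Multiset.card_cons] at hcard
  rw [curvature_cons, curvature_cons] at hΦ
  push_cast at hΦ
  have ht2 : t.card ≤ 2 := by
    have h := curvature_le_one_sub_card_div_six ht
    have h' : (t.card : ℚ) < 3 := by linarith
    have : t.card < 3 := by exact_mod_cast h'
    omega
  obtain h1 | h2 : t.card = 1 ∨ t.card = 2 := by omega
  · obtain ⟨m, rfl⟩ := Multiset.card_eq_one.1 h1
    have hm : (3 : ℤ) ≤ m := ht m (by simp)
    refine Or.inl ⟨m, hm, ?_, ?_⟩
    · by_contra! hlt
      have hm14 : (14 : ℚ) ≤ m := by exact_mod_cast (by omega : (14 : ℤ) ≤ m)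
      have hinv := one_div_le_one_div_of_le (by norm_num) hm14
      rw [← Multiset.cons_zero, curvature_cons, curvature_zero] at hΦ
      norm_num at hΦ hinv
      linarith
    · exact congrArg (Multiset.cons 3) (Multiset.pair_comm 11 m)
  · obtain ⟨a, b, rfl⟩ := Multiset.card_eq_two.1 h2
    have ha : (3 : ℤ) ≤ a := ht a (by simp)
    have hb : (3 : ℤ) ≤ b := ht b (by simp)
    have hsum : (19 / 33 : ℚ) ≤ 1 / a + 1 / b := by
      rw [Multiset.insert_eq_cons, ← Multiset.cons_zero b, curvature_cons, curvature_cons,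
        curvature_zero] at hΦ
      norm_num at hΦ ⊢
      linarith
    have inv_le {k n : ℤ} (hn : 0 < n) (h : n ≤ k) : (1 : ℚ) / k ≤ 1 / n :=
      one_div_le_one_div_of_le (by exact_mod_cast hn) (by exact_mod_cast h)
    have ha3 := inv_le (by norm_num) ha
    have hb3 := inv_le (by norm_num) hb
    have ha4 : a ≤ 4 := by
      by_contra! h
      have := inv_le (n := 5) (by norm_num) h
      norm_num at *
      linarith
    have hb4 : b ≤ 4 := by
      by_contra! h
      have := inv_le (n := 5) (by norm_num) h
      norm_num at *
      linarith
    right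
    clear ha3 hb3 hΦ h3 ht
    interval_cases a <;> interval_cases b
    · exact Or.inl (by decide)
    · exact Or.inr (by decide)
    · exact Or.inr (by decide)
    · norm_num at hsum
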